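/- Let E be an inner product space over ℂ with two differentials d, d^c, formal adjoints δ, δ^c, the commutation relations d ∘ d^c + d^c ∘ d = 0 and d ∘ δ^c + δ^c ∘ d = 0, equal Laplacians, and Hodge decompositions for both (d, δ) and (d^c, δ^c). Let H := (ker d) ⊓ (ker δ). Then every d^c-cohomology class is represented by an element of H: for every x ∈ E with d^c x = 0 there exists a unique h ∈ H such that x - h ∈ range d^c. -/

import Mathlib

open scoped ComplexInnerProductSpace

/-- `E` admits a Hodge decomposition for `(d, δ)`: the harmonic subspace
`H := ker d ⊓ ker δ`, the range of `d` and the range of `δ` are independent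
submodules whose supremum is all of `E`. -/
def HodgeDecomposition {E : Type*} [NormedAddCommGroup E] [InnerProductSpace ℂ E]
    (d δ : E →ₗ[ℂ] E) : Prop :=
  iSupIndep ![LinearMap.ker d ⊓ LinearMap.ker δ, LinearMap.range d, LinearMap.range δ] ∧
    (LinearMap.ker d ⊓ LinearMap.ker δ) ⊔ LinearMap.range d ⊔ LinearMap.range δ = ⊤

/-- The harmonic subspace is the kernel of the Laplacian. -/
theorem ker_inf_ker_eq_ker_laplacian
    {E : Type*} [NormedAddCommGroup E] [InnerProductSpace ℂ E] {d δ : E →ₗ[ℂ] E}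
    (hadj : ∀ x y : E, ⟪d x, y⟫ = ⟪x, δ y⟫) :
    LinearMap.ker d ⊓ LinearMap.ker δ = LinearMap.ker (d ∘ₗ δ + δ ∘ₗ d) := by
  ext x
  simp only [Submodule.mem_inf, LinearMap.mem_ker, LinearMap.add_apply, LinearMap.comp_apply]
  refine ⟨fun ⟨h₁, h₂⟩ => by simp [h₁, h₂], fun h => ?_⟩
  have key : ⟪x, d (δ x) + δ (d x)⟫ = ((‖δ x‖ ^ 2 + ‖d x‖ ^ 2 : ℝ) : ℂ) := by
    rw [inner_add_right, ← hadj x (d x), ← inner_conj_symm x, hadj (δ x) x,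
      inner_self_eq_norm_sq_to_K, inner_self_eq_norm_sq_to_K]
    simp
  rw [h, inner_zero_right] at key
  have hsum : ‖δ x‖ ^ 2 + ‖d x‖ ^ 2 = 0 := by exact_mod_cast key.symm
  constructor <;> rw [← norm_eq_zero, ← sq_eq_zero_iff] <;>
    nlinarith [sq_nonneg ‖δ x‖, sq_nonneg ‖d x‖]

/-- Under the assumptions of the formality theorem, every
`dc`-cohomology class is represented by a unique element of `H := ker d ⊓ ker δ`:
for every `x` with `dc x = 0` there is a unique `h ∈ H` with `x - h ∈ range dc`. -/
theorem dc_cohomology_harmonic_representative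
    {E : Type*} [NormedAddCommGroup E] [InnerProductSpace ℂ E]
    (d δ dc δc : E →ₗ[ℂ] E)
    (hd : d ∘ₗ d = 0) (hdc : dc ∘ₗ dc = 0)
    (hadj : ∀ x y : E, ⟪d x, y⟫ = ⟪x, δ y⟫)
    (hadjc : ∀ x y : E, ⟪dc x, y⟫ = ⟪x, δc y⟫)
    (hcomm₁ : d ∘ₗ dc + dc ∘ₗ d = 0)
    (hcomm₂ : d ∘ₗ δc + δc ∘ₗ d = 0)
    (hlap : d ∘ₗ δ + δ ∘ₗ d = dc ∘ₗ δc + δc ∘ₗ dc)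
    (hHodge : HodgeDecomposition d δ) (hHodgec : HodgeDecomposition dc δc) :
    ∀ x : E, dc x = 0 →
      ∃! h : E, h ∈ LinearMap.ker d ⊓ LinearMap.ker δ ∧ x - h ∈ LinearMap.range dc := by
  have hH : LinearMap.ker d ⊓ LinearMap.ker δ = LinearMap.ker dc ⊓ LinearMap.ker δc := by
    rw [ker_inf_ker_eq_ker_laplacian hadj, ker_inf_ker_eq_ker_laplacian hadjc, hlap]
  rw [hH]
  intro x hx
  have hmem : x ∈ (LinearMap.ker dc ⊓ LinearMap.ker δc) ⊔ LinearMap.range dc ⊔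
      LinearMap.range δc := hHodgec.2 ▸ Submodule.mem_top
  obtain ⟨y, hy, _, ⟨b, rfl⟩, rfl⟩ := Submodule.mem_sup.1 hmem
  obtain ⟨h, hh, _, ⟨a, rfl⟩, rfl⟩ := Submodule.mem_sup.1 hy
  have hdca : dc (dc a) = 0 := LinearMap.congr_fun hdc a
  have hdcb : dc (δc b) = 0 := by
    simpa [LinearMap.mem_ker.1 hh.1, hdca] using hx
  have hb : δc b = 0 := by
    rw [← inner_self_eq_zero (𝕜 := ℂ), ← hadjc, hdcb, inner_zero_left]
  refine ⟨h, ⟨hh, a, by simp [hb]⟩, ?_⟩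
  rintro h' ⟨hh', c, hc⟩
  have hdiff : h' - h = dc (a - c) := by
    rw [map_sub, hc, hb]
    abel
  have hδ : δc (h' - h) = 0 := (Submodule.sub_mem _ hh' hh).2
  rw [← sub_eq_zero, ← inner_self_eq_zero (𝕜 := ℂ)]
  nth_rw 1 [hdiff]
  rw [hadjc, hδ, inner_zero_right]
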